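/- arXiv:2303.01474 — 2 statements merged into one kernel-verified Lean document; each statement's English description precedes it below -/
import Mathlib

section
/- Assume f, g are twice continuously differentiable and −f(x,·), g_i(x,·) are convex on ℝᵐ for all x near x̄. Suppose the restricted sup-compactness holds at x̄, a stable parametric CQ holds at every y ∈ S(x̄) for the parametric system g(x,·) ≤ 0, and a stable CQ holds at every point (x̄,ỹ,λ̃) with ỹ ∈ S(x̄) and λ̃ ∈ Σ(x̄,ỹ) for the constraint system {(x,y,λ) : ∇_y L(x,y,λ) = 0, λ ≥ 0}. Then ∂V(x̄) ⊆ ∪_{y ∈ S(x̄)} {∇_x L(x̄,y,λ) + ∇²_{xy}L(x̄,y,λ)u : u ∈ Ξ¹(x̄,y,λ), λ ∈ Σ(x̄,y)} and ∂^∞V(x̄) ⊆ ∪_{y ∈ S(x̄)} {∇²_{xy}L(x̄,y,λ)u : u ∈ Ξ⁰(x̄,y,λ), λ ∈ Σ(x̄,y)}. -/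
open Filter Topology Metric RealInnerProductSpace

noncomputable section

/-- Feasible region of the parametric maximization problem. -/
def Feas {n m q : ℕ} (g : EuclideanSpace ℝ (Fin n) → EuclideanSpace ℝ (Fin m) → Fin q → ℝ)
    (x : EuclideanSpace ℝ (Fin n)) : Set (EuclideanSpace ℝ (Fin m)) :=
  {y | ∀ i, g x y i ≤ 0}

/-- Maximal value function (EReal valued; `sSup ∅ = ⊥ = -∞`). -/
def Vfun {n m q : ℕ} (f : EuclideanSpace ℝ (Fin n) → EuclideanSpace ℝ (Fin m) → ℝ)
    (g : EuclideanSpace ℝ (Fin n) → EuclideanSpace ℝ (Fin m) → Fin q → ℝ)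
    (x : EuclideanSpace ℝ (Fin n)) : EReal :=
  sSup ((fun y => (f x y : EReal)) '' Feas g x)

/-- Solution map of the parametric maximization problem. -/
def Sol {n m q : ℕ} (f : EuclideanSpace ℝ (Fin n) → EuclideanSpace ℝ (Fin m) → ℝ)
    (g : EuclideanSpace ℝ (Fin n) → EuclideanSpace ℝ (Fin m) → Fin q → ℝ)
    (x : EuclideanSpace ℝ (Fin n)) : Set (EuclideanSpace ℝ (Fin m)) :=
  {y ∈ Feas g x | (f x y : EReal) = Vfun f g x}

/-- Lagrangian `L(x,y,λ) = f(x,y) - λᵀ g(x,y)`. -/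
def Lag {n m q : ℕ} (f : EuclideanSpace ℝ (Fin n) → EuclideanSpace ℝ (Fin m) → ℝ)
    (g : EuclideanSpace ℝ (Fin n) → EuclideanSpace ℝ (Fin m) → Fin q → ℝ)
    (x : EuclideanSpace ℝ (Fin n)) (y : EuclideanSpace ℝ (Fin m)) (lam : Fin q → ℝ) : ℝ :=
  f x y - ∑ i, lam i * g x y i

/-- Partial gradient in `x`. -/
def gradx {n m : ℕ} (φ : EuclideanSpace ℝ (Fin n) → EuclideanSpace ℝ (Fin m) → ℝ)
    (x : EuclideanSpace ℝ (Fin n)) (y : EuclideanSpace ℝ (Fin m)) : EuclideanSpace ℝ (Fin n) :=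
  gradient (fun x' => φ x' y) x

/-- Partial gradient in `y`. -/
def grady {n m : ℕ} (φ : EuclideanSpace ℝ (Fin n) → EuclideanSpace ℝ (Fin m) → ℝ)
    (x : EuclideanSpace ℝ (Fin n)) (y : EuclideanSpace ℝ (Fin m)) : EuclideanSpace ℝ (Fin m) :=
  gradient (fun y' => φ x y') y

/-- `∇_y L(x,y,λ)`. -/
def gradyL {n m q : ℕ} (f : EuclideanSpace ℝ (Fin n) → EuclideanSpace ℝ (Fin m) → ℝ)
    (g : EuclideanSpace ℝ (Fin n) → EuclideanSpace ℝ (Fin m) → Fin q → ℝ)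
    (x : EuclideanSpace ℝ (Fin n)) (y : EuclideanSpace ℝ (Fin m)) (lam : Fin q → ℝ) :
    EuclideanSpace ℝ (Fin m) :=
  grady (fun x y => Lag f g x y lam) x y

/-- `∇_x L(x,y,λ)`. -/
def gradxL {n m q : ℕ} (f : EuclideanSpace ℝ (Fin n) → EuclideanSpace ℝ (Fin m) → ℝ)
    (g : EuclideanSpace ℝ (Fin n) → EuclideanSpace ℝ (Fin m) → Fin q → ℝ)
    (x : EuclideanSpace ℝ (Fin n)) (y : EuclideanSpace ℝ (Fin m)) (lam : Fin q → ℝ) :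
    EuclideanSpace ℝ (Fin n) :=
  gradx (fun x y => Lag f g x y lam) x y

/-- `∇_y g(x,y)ᵀ u ∈ ℝ^q`. -/
def gyTu {n m q : ℕ} (g : EuclideanSpace ℝ (Fin n) → EuclideanSpace ℝ (Fin m) → Fin q → ℝ)
    (x : EuclideanSpace ℝ (Fin n)) (y : EuclideanSpace ℝ (Fin m)) (u : EuclideanSpace ℝ (Fin m)) :
    Fin q → ℝ :=
  fun i => ⟪grady (fun x y => g x y i) x y, u⟫

/-- `∇²_{yy} L(x,y,λ) u`. -/
def hessyyLu {n m q : ℕ} (f : EuclideanSpace ℝ (Fin n) → EuclideanSpace ℝ (Fin m) → ℝ)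
    (g : EuclideanSpace ℝ (Fin n) → EuclideanSpace ℝ (Fin m) → Fin q → ℝ)
    (x : EuclideanSpace ℝ (Fin n)) (y : EuclideanSpace ℝ (Fin m)) (lam : Fin q → ℝ)
    (u : EuclideanSpace ℝ (Fin m)) : EuclideanSpace ℝ (Fin m) :=
  gradient (fun y' => ⟪gradyL f g x y' lam, u⟫) y

/-- `∇²_{xy} L(x,y,λ) u ∈ ℝⁿ` (for `u ∈ ℝᵐ`). -/
def hessxyLu {n m q : ℕ} (f : EuclideanSpace ℝ (Fin n) → EuclideanSpace ℝ (Fin m) → ℝ)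
    (g : EuclideanSpace ℝ (Fin n) → EuclideanSpace ℝ (Fin m) → Fin q → ℝ)
    (x : EuclideanSpace ℝ (Fin n)) (y : EuclideanSpace ℝ (Fin m)) (lam : Fin q → ℝ)
    (u : EuclideanSpace ℝ (Fin m)) : EuclideanSpace ℝ (Fin n) :=
  gradient (fun x' => ⟪gradyL f g x' y lam, u⟫) x

/-- Multiplier set `Σ(x,y)`. -/
def SigmaSet {n m q : ℕ} (f : EuclideanSpace ℝ (Fin n) → EuclideanSpace ℝ (Fin m) → ℝ)
    (g : EuclideanSpace ℝ (Fin n) → EuclideanSpace ℝ (Fin m) → Fin q → ℝ)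
    (x : EuclideanSpace ℝ (Fin n)) (y : EuclideanSpace ℝ (Fin m)) : Set (Fin q → ℝ) :=
  {lam | gradyL f g x y lam = 0 ∧ (∀ i, 0 ≤ lam i) ∧ (∀ i, g x y i ≤ 0) ∧
    ∑ i, lam i * g x y i = 0}

/-- Singular multiplier set `Σ⁰(x,y)`. -/
def SigmaZero {n m q : ℕ} (g : EuclideanSpace ℝ (Fin n) → EuclideanSpace ℝ (Fin m) → Fin q → ℝ)
    (x : EuclideanSpace ℝ (Fin n)) (y : EuclideanSpace ℝ (Fin m)) : Set (Fin q → ℝ) :=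
  {lam | ∑ i, lam i • grady (fun x y => g x y i) x y = 0 ∧ (∀ i, 0 ≤ lam i) ∧
    (∀ i, g x y i ≤ 0) ∧ ∑ i, lam i * g x y i = 0}

/-- The set `Ξ^r(x,y,λ)`. -/
def XiSet {n m q : ℕ} (r : ℝ) (f : EuclideanSpace ℝ (Fin n) → EuclideanSpace ℝ (Fin m) → ℝ)
    (g : EuclideanSpace ℝ (Fin n) → EuclideanSpace ℝ (Fin m) → Fin q → ℝ)
    (x : EuclideanSpace ℝ (Fin n)) (y : EuclideanSpace ℝ (Fin m)) (lam : Fin q → ℝ) :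
    Set (EuclideanSpace ℝ (Fin m)) :=
  {u | hessyyLu f g x y lam u = 0 ∧ (∀ i, 0 ≤ -(gyTu g x y u i) - r * g x y i) ∧
    (∀ i, 0 ≤ lam i) ∧ ∑ i, lam i * (-(gyTu g x y u i) - r * g x y i) = 0}

/-- Fréchet (regular) subdifferential of an `EReal` valued function. -/
def FSub {n : ℕ} (φ : EuclideanSpace ℝ (Fin n) → EReal) (x₀ : EuclideanSpace ℝ (Fin n)) :
    Set (EuclideanSpace ℝ (Fin n)) :=
  {v | ∃ c : ℝ, φ x₀ = (c : EReal) ∧ ∀ ε : ℝ, 0 < ε → ∃ δ : ℝ, 0 < δ ∧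
    ∀ x, ‖x - x₀‖ < δ → ((c + ⟪v, x - x₀⟫ - ε * ‖x - x₀‖ : ℝ) : EReal) ≤ φ x}

/-- Limiting (Mordukhovich) subdifferential. -/
def LSub {n : ℕ} (φ : EuclideanSpace ℝ (Fin n) → EReal) (x₀ : EuclideanSpace ℝ (Fin n)) :
    Set (EuclideanSpace ℝ (Fin n)) :=
  {v | ∃ (xk : ℕ → EuclideanSpace ℝ (Fin n)) (vk : ℕ → EuclideanSpace ℝ (Fin n)),
    (∀ k, vk k ∈ FSub φ (xk k)) ∧ Tendsto xk atTop (𝓝 x₀) ∧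
    Tendsto (fun k => φ (xk k)) atTop (𝓝 (φ x₀)) ∧ Tendsto vk atTop (𝓝 v)}

/-- Horizon (singular) subdifferential. -/
def HorSub {n : ℕ} (φ : EuclideanSpace ℝ (Fin n) → EReal) (x₀ : EuclideanSpace ℝ (Fin n)) :
    Set (EuclideanSpace ℝ (Fin n)) :=
  {v | ∃ (xk : ℕ → EuclideanSpace ℝ (Fin n)) (vk : ℕ → EuclideanSpace ℝ (Fin n)) (tk : ℕ → ℝ),
    (∀ k, vk k ∈ FSub φ (xk k)) ∧ (∀ k, 0 < tk k) ∧ Tendsto tk atTop (𝓝 0) ∧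
    Tendsto xk atTop (𝓝 x₀) ∧ Tendsto (fun k => φ (xk k)) atTop (𝓝 (φ x₀)) ∧
    Tendsto (fun k => tk k • vk k) atTop (𝓝 v)}

/-- Clarke subdifferential (for locally Lipschitz functions): convex hull of the limiting one. -/
def CSub {n : ℕ} (φ : EuclideanSpace ℝ (Fin n) → EReal) (x₀ : EuclideanSpace ℝ (Fin n)) :
    Set (EuclideanSpace ℝ (Fin n)) :=
  convexHull ℝ (LSub φ x₀)

/-- `φ` is (finite-valued and) Lipschitz continuous near `x₀`. -/
def LipschitzNearAt {n : ℕ} (φ : EuclideanSpace ℝ (Fin n) → EReal)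
    (x₀ : EuclideanSpace ℝ (Fin n)) : Prop :=
  ∃ δ : ℝ, 0 < δ ∧ ∃ K : NNReal, ∃ ψ : EuclideanSpace ℝ (Fin n) → ℝ,
    LipschitzWith K ψ ∧ ∀ x ∈ ball x₀ δ, φ x = (ψ x : EReal)

/-- Regular (Fréchet) normal cone. -/
def regNC {n : ℕ} (C : Set (EuclideanSpace ℝ (Fin n))) (x₀ : EuclideanSpace ℝ (Fin n)) :
    Set (EuclideanSpace ℝ (Fin n)) :=
  {ξ | ∀ ε : ℝ, 0 < ε → ∃ δ : ℝ, 0 < δ ∧ ∀ x ∈ C, ‖x - x₀‖ < δ →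
    ⟪ξ, x - x₀⟫ ≤ ε * ‖x - x₀‖}

/-- Limiting (Mordukhovich) normal cone. -/
def limNC {n : ℕ} (C : Set (EuclideanSpace ℝ (Fin n))) (x₀ : EuclideanSpace ℝ (Fin n)) :
    Set (EuclideanSpace ℝ (Fin n)) :=
  {ξ | ∃ (xk : ℕ → EuclideanSpace ℝ (Fin n)) (ξk : ℕ → EuclideanSpace ℝ (Fin n)),
    (∀ k, xk k ∈ C) ∧ (∀ k, ξk k ∈ regNC C (xk k)) ∧
    Tendsto xk atTop (𝓝 x₀) ∧ Tendsto ξk atTop (𝓝 ξ)}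

/-- Inner semicontinuity of the solution map at `(x̄, ȳ)`. -/
def InnerSemicont {n m q : ℕ} (f : EuclideanSpace ℝ (Fin n) → EuclideanSpace ℝ (Fin m) → ℝ)
    (g : EuclideanSpace ℝ (Fin n) → EuclideanSpace ℝ (Fin m) → Fin q → ℝ)
    (xb : EuclideanSpace ℝ (Fin n)) (yb : EuclideanSpace ℝ (Fin m)) : Prop :=
  ∀ xk : ℕ → EuclideanSpace ℝ (Fin n), Tendsto xk atTop (𝓝 xb) →
    ∃ yk : ℕ → EuclideanSpace ℝ (Fin m), (∀ k, yk k ∈ Sol f g (xk k)) ∧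
      Tendsto yk atTop (𝓝 yb)

/-- Local error bound for the system `g(x,y) ≤ 0` at `(x̄, ȳ)`. -/
def LocalErrorBound {n m q : ℕ}
    (g : EuclideanSpace ℝ (Fin n) → EuclideanSpace ℝ (Fin m) → Fin q → ℝ)
    (xb : EuclideanSpace ℝ (Fin n)) (yb : EuclideanSpace ℝ (Fin m)) : Prop :=
  ∃ κ δ : ℝ, 0 < κ ∧ 0 < δ ∧
    ∀ x y, ‖((x, y) : EuclideanSpace ℝ (Fin n) × EuclideanSpace ℝ (Fin m)) - (xb, yb)‖ < δ →
      Metric.infDist ((x, y) : EuclideanSpace ℝ (Fin n) × EuclideanSpace ℝ (Fin m))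
          {p : EuclideanSpace ℝ (Fin n) × EuclideanSpace ℝ (Fin m) | ∀ i, g p.1 p.2 i ≤ 0}
        ≤ κ * ∑ i, max (g x y i) 0

/-- MFCQ for the system `g(x̄, ·) ≤ 0` at `ȳ`. -/
def MFCQy {n m q : ℕ} (g : EuclideanSpace ℝ (Fin n) → EuclideanSpace ℝ (Fin m) → Fin q → ℝ)
    (xb : EuclideanSpace ℝ (Fin n)) (yb : EuclideanSpace ℝ (Fin m)) : Prop :=
  ∀ lam : Fin q → ℝ, (∀ i, 0 ≤ lam i) → (∑ i, lam i * g xb yb i = 0) →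
    (∀ i, g xb yb i ≤ 0) → (∑ i, lam i • grady (fun x y => g x y i) xb yb = 0) → lam = 0

/-- Restricted sup-compactness at `x̄`. -/
def RestrictedSupCompact {n m q : ℕ}
    (f : EuclideanSpace ℝ (Fin n) → EuclideanSpace ℝ (Fin m) → ℝ)
    (g : EuclideanSpace ℝ (Fin n) → EuclideanSpace ℝ (Fin m) → Fin q → ℝ)
    (xb : EuclideanSpace ℝ (Fin n)) : Prop :=
  (∃ c : ℝ, Vfun f g xb = (c : EReal)) ∧
  ∃ ε δ : ℝ, 0 < ε ∧ 0 < δ ∧ ∃ Ω : Set (EuclideanSpace ℝ (Fin m)), IsCompact Ω ∧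
    ∀ x, ‖x - xb‖ < δ → Vfun f g xb - (ε : EReal) < Vfun f g x → (Sol f g x ∩ Ω).Nonempty

/-- Robinson stability of the feasible map at `(x̄, ȳ)`. -/
def RobinsonStability {n m q : ℕ}
    (g : EuclideanSpace ℝ (Fin n) → EuclideanSpace ℝ (Fin m) → Fin q → ℝ)
    (xb : EuclideanSpace ℝ (Fin n)) (yb : EuclideanSpace ℝ (Fin m)) : Prop :=
  ∃ κ δ : ℝ, 0 < κ ∧ 0 < δ ∧
    ∀ x y, ‖((x, y) : EuclideanSpace ℝ (Fin n) × EuclideanSpace ℝ (Fin m)) - (xb, yb)‖ < δ →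
      Metric.infDist y (Feas g x) ≤ κ * ∑ i, max (g x y i) 0

/-- A constraint qualification holds at the feasible point `w₀` of the system
`{w : G w ≤ 0, H w = 0}`: local minimizers of C¹ functions over the feasible set
satisfy the KKT conditions. -/
def CQAt {W : Type} [NormedAddCommGroup W] [NormedSpace ℝ W] {p p' : ℕ}
    (G : W → Fin p → ℝ) (H : W → Fin p' → ℝ) (w₀ : W) : Prop :=
  ∀ θ : W → ℝ, ContDiff ℝ 1 θ →
    IsLocalMinOn θ {w | (∀ i, G w i ≤ 0) ∧ ∀ j, H w j = 0} w₀ →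
    ∃ (lam : Fin p → ℝ) (mu : Fin p' → ℝ), (∀ i, 0 ≤ lam i) ∧
      (fderiv ℝ θ w₀ + ∑ i, lam i • fderiv ℝ (fun w => G w i) w₀ +
        ∑ j, mu j • fderiv ℝ (fun w => H w j) w₀ = 0) ∧
      ∑ i, lam i * G w₀ i = 0

/-- Inequality constraints of the Wolfe dual system (`λ ≥ 0`). -/
def WolfeG (n m q : ℕ) :
    (EuclideanSpace ℝ (Fin n) × EuclideanSpace ℝ (Fin m) × (Fin q → ℝ)) → Fin q → ℝ :=
  fun w i => -(w.2.2 i)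

/-- Equality constraints of the Wolfe dual system (`∇_y L(x,y,λ) = 0`). -/
def WolfeH {n m q : ℕ} (f : EuclideanSpace ℝ (Fin n) → EuclideanSpace ℝ (Fin m) → ℝ)
    (g : EuclideanSpace ℝ (Fin n) → EuclideanSpace ℝ (Fin m) → Fin q → ℝ) :
    (EuclideanSpace ℝ (Fin n) × EuclideanSpace ℝ (Fin m) × (Fin q → ℝ)) → Fin m → ℝ :=
  fun w j => gradyL f g w.1 w.2.1 w.2.2 j

/-- The multiplier set `M(β, x, y)` of the parametric program. -/
def MultSetP {n m q : ℕ} (g : EuclideanSpace ℝ (Fin n) → EuclideanSpace ℝ (Fin m) → Fin q → ℝ)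
    (β : EuclideanSpace ℝ (Fin m)) (x : EuclideanSpace ℝ (Fin n))
    (y : EuclideanSpace ℝ (Fin m)) : Set (Fin q → ℝ) :=
  {lam | β - ∑ i, lam i • grady (fun x y => g x y i) x y = 0 ∧ (∀ i, 0 ≤ lam i) ∧
    ∑ i, lam i * g x y i = 0 ∧ ∀ i, g x y i ≤ 0}

/-- A stable parametric CQ holds at `ȳ ∈ F(x̄)` for the parametric system `g(x,·) ≤ 0`. -/
def StableParamCQ {n m q : ℕ} (f : EuclideanSpace ℝ (Fin n) → EuclideanSpace ℝ (Fin m) → ℝ)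
    (g : EuclideanSpace ℝ (Fin n) → EuclideanSpace ℝ (Fin m) → Fin q → ℝ)
    (xb : EuclideanSpace ℝ (Fin n)) (yb : EuclideanSpace ℝ (Fin m)) : Prop :=
  ∃ P : EuclideanSpace ℝ (Fin n) → EuclideanSpace ℝ (Fin m) → Prop,
    (∃ δ : ℝ, 0 < δ ∧ ∀ x y, y ∈ Feas g x → ‖x - xb‖ < δ → ‖y - yb‖ < δ → P x y) ∧
    (∀ x y, P x y → y ∈ Feas g x → IsLocalMaxOn (f x) (Feas g x) y →
      (MultSetP g (grady f x y) x y).Nonempty) ∧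
    (∀ (βk : ℕ → EuclideanSpace ℝ (Fin m)) (xk : ℕ → EuclideanSpace ℝ (Fin n))
        (yk : ℕ → EuclideanSpace ℝ (Fin m)) (βb : EuclideanSpace ℝ (Fin m)),
      Tendsto βk atTop (𝓝 βb) → Tendsto xk atTop (𝓝 xb) → Tendsto yk atTop (𝓝 yb) →
      (∀ k, (MultSetP g (βk k) (xk k) (yk k)).Nonempty) →
      ∃ (lamk : ℕ → Fin q → ℝ) (φ : ℕ → ℕ) (lamb : Fin q → ℝ),
        StrictMono φ ∧ (∀ k, lamk k ∈ MultSetP g (βk k) (xk k) (yk k)) ∧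
        Tendsto (lamk ∘ φ) atTop (𝓝 lamb) ∧ lamb ∈ MultSetP g βb xb yb)

/-- The multiplier set `M(β, w)` of a (nonparametric) system `{w : G w ≤ 0, H w = 0}`. -/
def MultSetW {W : Type} [NormedAddCommGroup W] [NormedSpace ℝ W] {p p' : ℕ}
    (G : W → Fin p → ℝ) (H : W → Fin p' → ℝ) (β : W →L[ℝ] ℝ) (w : W) :
    Set ((Fin p → ℝ) × (Fin p' → ℝ)) :=
  {lm | (∀ i, 0 ≤ lm.1 i) ∧
    (β - ∑ i, lm.1 i • fderiv ℝ (fun w => G w i) w -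
      ∑ j, lm.2 j • fderiv ℝ (fun w => H w j) w = 0) ∧
    ∑ i, lm.1 i * G w i = 0}

/-- A stable CQ holds at the feasible point `w̄` of the system `{w : G w ≤ 0, H w = 0}`. -/
def StableCQ {W : Type} [NormedAddCommGroup W] [NormedSpace ℝ W] {p p' : ℕ}
    (G : W → Fin p → ℝ) (H : W → Fin p' → ℝ) (wb : W) : Prop :=
  ∃ P : W → Prop,
    (P wb ∧ ∃ δ : ℝ, 0 < δ ∧ ∀ w, (∀ i, G w i ≤ 0) → (∀ j, H w j = 0) → ‖w - wb‖ < δ → P w) ∧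
    (∀ w, P w → (∀ i, G w i ≤ 0) → (∀ j, H w j = 0) →
      ∀ θ : W → ℝ, ContDiff ℝ 1 θ →
        IsLocalMinOn θ {w' | (∀ i, G w' i ≤ 0) ∧ ∀ j, H w' j = 0} w →
        ∃ (lam : Fin p → ℝ) (mu : Fin p' → ℝ), (∀ i, 0 ≤ lam i) ∧
          (fderiv ℝ θ w + ∑ i, lam i • fderiv ℝ (fun w => G w i) w +
            ∑ j, mu j • fderiv ℝ (fun w => H w j) w = 0) ∧
          ∑ i, lam i * G w i = 0) ∧
    (∀ (βk : ℕ → W →L[ℝ] ℝ) (wk : ℕ → W) (βb : W →L[ℝ] ℝ),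
      Tendsto βk atTop (𝓝 βb) → Tendsto wk atTop (𝓝 wb) →
      (∀ k, (∀ i, G (wk k) i ≤ 0) ∧ ∀ j, H (wk k) j = 0) →
      (∀ k, (MultSetW G H (βk k) (wk k)).Nonempty) →
      ∃ (lmk : ℕ → (Fin p → ℝ) × (Fin p' → ℝ)) (φ : ℕ → ℕ) (lmb : (Fin p → ℝ) × (Fin p' → ℝ)),
        StrictMono φ ∧ (∀ k, lmk k ∈ MultSetW G H (βk k) (wk k)) ∧
        Tendsto (lmk ∘ φ) atTop (𝓝 lmb) ∧ lmb ∈ MultSetW G H βb wb)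

/-- Critical cone of `(P_x̄)` at `y` associated with the multiplier `λ`. -/
def CritCone {n m q : ℕ} (g : EuclideanSpace ℝ (Fin n) → EuclideanSpace ℝ (Fin m) → Fin q → ℝ)
    (xb : EuclideanSpace ℝ (Fin n)) (y : EuclideanSpace ℝ (Fin m)) (lam : Fin q → ℝ) :
    Set (EuclideanSpace ℝ (Fin m)) :=
  {d | ∀ i, g xb y i = 0 →
    (0 < lam i → ⟪grady (fun x y => g x y i) xb y, d⟫ = 0) ∧
    (lam i = 0 → ⟪grady (fun x y => g x y i) xb y, d⟫ ≤ 0)}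

/-- Second order sufficient condition at `(y, λ)` for `(P_x̄)`. -/
def SOSC {n m q : ℕ} (f : EuclideanSpace ℝ (Fin n) → EuclideanSpace ℝ (Fin m) → ℝ)
    (g : EuclideanSpace ℝ (Fin n) → EuclideanSpace ℝ (Fin m) → Fin q → ℝ)
    (xb : EuclideanSpace ℝ (Fin n)) (y : EuclideanSpace ℝ (Fin m)) (lam : Fin q → ℝ) : Prop :=
  ∀ d ∈ CritCone g xb y lam, d ≠ 0 → ⟪d, hessyyLu f g xb y lam d⟫ < 0

/-- `(x̄, ȳ)` is a local solution of the minimax problem in the sense of Stackelberg. -/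
def StackelbergLocal {n m q : ℕ} (f : EuclideanSpace ℝ (Fin n) → EuclideanSpace ℝ (Fin m) → ℝ)
    (g : EuclideanSpace ℝ (Fin n) → EuclideanSpace ℝ (Fin m) → Fin q → ℝ)
    (X : Set (EuclideanSpace ℝ (Fin n))) (xb : EuclideanSpace ℝ (Fin n))
    (yb : EuclideanSpace ℝ (Fin m)) : Prop :=
  xb ∈ X ∧ yb ∈ Sol f g xb ∧ IsLocalMinOn (Vfun f g) X xb

/-- Feasible region of the MPEC reformulation `(P_MPEC)`. -/
def MPECFeas {n m q : ℕ} (f : EuclideanSpace ℝ (Fin n) → EuclideanSpace ℝ (Fin m) → ℝ)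
    (g : EuclideanSpace ℝ (Fin n) → EuclideanSpace ℝ (Fin m) → Fin q → ℝ)
    (X : Set (EuclideanSpace ℝ (Fin n))) :
    Set (EuclideanSpace ℝ (Fin n) × EuclideanSpace ℝ (Fin m) × (Fin q → ℝ)) :=
  {w | w.1 ∈ X ∧ gradyL f g w.1 w.2.1 w.2.2 = 0 ∧ (∀ i, g w.1 w.2.1 i ≤ 0) ∧
    (∀ i, 0 ≤ w.2.2 i) ∧ ∑ i, w.2.2 i * g w.1 w.2.1 i = 0}

/-- S-stationarity for `(P_MPEC)`. -/
def SStationary {n m q : ℕ} (f : EuclideanSpace ℝ (Fin n) → EuclideanSpace ℝ (Fin m) → ℝ)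
    (g : EuclideanSpace ℝ (Fin n) → EuclideanSpace ℝ (Fin m) → Fin q → ℝ)
    (X : Set (EuclideanSpace ℝ (Fin n))) (xb : EuclideanSpace ℝ (Fin n))
    (yb : EuclideanSpace ℝ (Fin m)) (lamb : Fin q → ℝ) : Prop :=
  ∃ (u : EuclideanSpace ℝ (Fin m)) (α β : Fin q → ℝ),
    -(gradx f xb yb + ∑ i, α i • gradx (fun x y => g x y i) xb yb +
        hessxyLu f g xb yb lamb u) ∈ limNC X xb ∧
    grady f xb yb + ∑ i, α i • grady (fun x y => g x y i) xb yb +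
      hessyyLu f g xb yb lamb u = 0 ∧
    (∀ i, -(gyTu g xb yb u i) - β i = 0) ∧
    (∀ i, g xb yb i < 0 → lamb i = 0 → α i = 0) ∧
    (∀ i, g xb yb i = 0 → 0 < lamb i → β i = 0) ∧
    (∀ i, g xb yb i = 0 → lamb i = 0 → 0 ≤ α i ∧ 0 ≤ β i)


/-- Optimal value function of the Wolfe dual (`sInf ∅ = ⊤`). -/
def VD {n m q : ℕ} (f : EuclideanSpace ℝ (Fin n) → EuclideanSpace ℝ (Fin m) → ℝ)
    (g : EuclideanSpace ℝ (Fin n) → EuclideanSpace ℝ (Fin m) → Fin q → ℝ)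
    (x : EuclideanSpace ℝ (Fin n)) : EReal :=
  sInf ((fun p : EuclideanSpace ℝ (Fin m) × (Fin q → ℝ) => (Lag f g x p.1 p.2 : EReal)) ''
    {p | gradyL f g x p.1 p.2 = 0 ∧ ∀ i, 0 ≤ p.2 i})

/-- Strict differentiability of an `EReal`-valued function at `x₀` with gradient `ζ`. -/
def StrictDiffAt {n : ℕ} (φ : EuclideanSpace ℝ (Fin n) → EReal)
    (x₀ ζ : EuclideanSpace ℝ (Fin n)) : Prop :=
  ∀ ε : ℝ, 0 < ε → ∃ δ : ℝ, 0 < δ ∧ ∀ x x', ‖x - x₀‖ < δ → ‖x' - x₀‖ < δ →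
    ∃ a b : ℝ, φ x = (a : EReal) ∧ φ x' = (b : EReal) ∧
      |a - b - ⟪ζ, x - x'⟫| ≤ ε * ‖x - x'‖

/-- `f` and `g` are separable with respect to `x` and `y`. -/
def SeparableFG {n m q : ℕ} (f : EuclideanSpace ℝ (Fin n) → EuclideanSpace ℝ (Fin m) → ℝ)
    (g : EuclideanSpace ℝ (Fin n) → EuclideanSpace ℝ (Fin m) → Fin q → ℝ) : Prop :=
  ∃ (f₁ : EuclideanSpace ℝ (Fin n) → ℝ) (f₂ : EuclideanSpace ℝ (Fin m) → ℝ)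
    (g₁ : EuclideanSpace ℝ (Fin n) → Fin q → ℝ) (g₂ : EuclideanSpace ℝ (Fin m) → Fin q → ℝ),
    (∀ x y, f x y = f₁ x + f₂ y) ∧ ∀ x y i, g x y i = g₁ x i + g₂ y i

end

section SmoothMinorant

variable {E : Type*} [NormedAddCommGroup E] [InnerProductSpace ℝ E]

theorem hasFDerivAt_sqrt_norm_sq_add_sq {d : ℝ} (hd : 0 < d) (x : E) :
    HasFDerivAt (fun h : E => √(‖h‖ ^ 2 + d ^ 2) - d)
      ((√(‖x‖ ^ 2 + d ^ 2))⁻¹ • innerSL ℝ x) x := by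
  have hne : ‖x‖ ^ 2 + d ^ 2 ≠ 0 := by positivity
  have h := (((hasStrictFDerivAt_norm_sq x).hasFDerivAt.add_const (d ^ 2)).sqrt hne).sub_const d
  refine h.congr_fderiv ?_
  ext v
  simp
  ring

theorem norm_inv_sqrt_smul_innerSL_le {d : ℝ} (hd : 0 < d) (x : E) :
    ‖(√(‖x‖ ^ 2 + d ^ 2))⁻¹ • innerSL ℝ x‖ ≤ 1 := by
  rw [norm_smul, innerSL_apply_norm, norm_inv, Real.norm_of_nonneg (Real.sqrt_nonneg _),
    inv_mul_le_iff₀ (by positivity), mul_one]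
  exact Real.le_sqrt_of_sq_le (by nlinarith)

theorem le_three_mul_sqrt_sub {d t : ℝ} (hd : 0 < d) (ht : d ≤ t) :
    t ≤ 3 * (√(t ^ 2 + d ^ 2) - d) := by
  have : t / 3 + d ≤ √(t ^ 2 + d ^ 2) := Real.le_sqrt_of_sq_le (by nlinarith)
  linarith

/-- A nonnegative `C¹` function with vanishing value and derivative at the origin which dominates
`2⁻ʲ ‖h‖` outside the ball of radius `d j`. -/
theorem exists_contDiff_one_dominating (d : ℕ → ℝ) (hd : ∀ j, 0 < d j) :
    ∃ ψ : E → ℝ, ContDiff ℝ 1 ψ ∧ ψ 0 = 0 ∧ fderiv ℝ ψ 0 = 0 ∧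
      ∀ j h, d j ≤ ‖h‖ → (1 / 2 : ℝ) ^ j * ‖h‖ ≤ ψ h := by
  set F : ℕ → E → ℝ := fun j h => (3 * (1 / 2 : ℝ) ^ j) * (√(‖h‖ ^ 2 + d j ^ 2) - d j) with hF
  set F' : ℕ → E → E →L[ℝ] ℝ := fun j x =>
    (3 * (1 / 2 : ℝ) ^ j) • ((√(‖x‖ ^ 2 + d j ^ 2))⁻¹ • innerSL ℝ x) with hF'
  have hu : Summable fun j : ℕ => 3 * (1 / 2 : ℝ) ^ j :=
    (summable_geometric_of_lt_one (by norm_num) (by norm_num)).mul_left 3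
  have hder : ∀ j x, HasFDerivAt (F j) (F' j x) x := fun j x =>
    (hasFDerivAt_sqrt_norm_sq_add_sq (hd j) x).const_mul _
  have hbound : ∀ j x, ‖F' j x‖ ≤ 3 * (1 / 2 : ℝ) ^ j := by
    intro j x
    rw [hF']
    simp only
    rw [norm_smul, Real.norm_of_nonneg (by positivity)]
    exact mul_le_of_le_one_right (by positivity) (norm_inv_sqrt_smul_innerSL_le (hd j) x)
  have hzero : ∀ j, F j 0 = 0 := by
    intro j
    simp [hF, Real.sqrt_sq (hd j).le]
  have hsum0 : Summable fun j => F j 0 := by simp [hzero]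
  have htsum : ∀ x, HasFDerivAt (fun y => ∑' j, F j y) (∑' j, F' j x) x :=
    hasFDerivAt_tsum hu hder hbound hsum0
  have hcont : Continuous fun x => ∑' j, F' j x := by
    refine continuous_tsum (fun j => ?_) hu hbound
    have hne : ∀ x : E, √(‖x‖ ^ 2 + d j ^ 2) ≠ 0 := fun x => by
      have := hd j
      positivity
    have hc : Continuous fun x : E => (√(‖x‖ ^ 2 + d j ^ 2))⁻¹ :=
      Continuous.inv₀ (by fun_prop) hne
    exact (hc.smul (innerSL ℝ (E := E)).continuous).const_smul (3 * (1 / 2 : ℝ) ^ j)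
  refine ⟨fun h => ∑' j, F j h, ?_, ?_, ?_, ?_⟩
  · rw [contDiff_one_iff_fderiv]
    refine ⟨fun x => (htsum x).differentiableAt, ?_⟩
    rwa [show fderiv ℝ (fun h => ∑' j, F j h) = fun x => ∑' j, F' j x from
      funext fun x => (htsum x).fderiv]
  · simp [hzero]
  · rw [(htsum 0).fderiv]
    simp [hF']
  · intro j h hh
    have hs : Summable fun j => F j h := summable_of_summable_hasFDerivAt hu hder hbound hsum0 h
    have hnn : ∀ i, 0 ≤ F i h := by
      intro i
      refine mul_nonneg (by positivity) (sub_nonneg.2 ?_)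
      exact Real.le_sqrt_of_sq_le (by nlinarith [sq_nonneg ‖h‖])
    refine le_trans ?_ (hs.le_tsum j fun i _ => hnn i)
    calc (1 / 2 : ℝ) ^ j * ‖h‖
        ≤ (1 / 2 : ℝ) ^ j * (3 * (√(‖h‖ ^ 2 + d j ^ 2) - d j)) := by
          gcongr
          exact le_three_mul_sqrt_sub (hd j) hh
      _ = F j h := by simp only [hF]; ring

end SmoothMinorant

/-- A Fréchet subgradient is the gradient of a `C¹` function supporting `φ` locally from below. -/
theorem exists_contDiff_one_minorant_of_mem_FSub {n : ℕ} {φ : EuclideanSpace ℝ (Fin n) → EReal}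
    {x₀ v : EuclideanSpace ℝ (Fin n)} (hv : v ∈ FSub φ x₀) :
    ∃ (c : ℝ) (ψ : EuclideanSpace ℝ (Fin n) → ℝ), φ x₀ = c ∧ ContDiff ℝ 1 ψ ∧ ψ 0 = 0 ∧
      fderiv ℝ ψ 0 = 0 ∧
      ∀ᶠ x in 𝓝 x₀, ((c + ⟪v, x - x₀⟫ - ψ (x - x₀) : ℝ) : EReal) ≤ φ x := by
  obtain ⟨c, hc, hv⟩ := hv
  choose r hr hrv using fun j : ℕ => hv ((1 / 2 : ℝ) ^ j) (by positivity)
  set d : ℕ → ℝ := fun j => min (r j) (1 / (j + 1 : ℝ)) with hd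
  have hdpos : ∀ j, 0 < d j := fun j => lt_min (hr j) (by positivity)
  obtain ⟨ψ, hψ, hψ0, hψ', hdom⟩ :=
    exists_contDiff_one_dominating (E := EuclideanSpace ℝ (Fin n)) (fun j => d (j + 1))
      fun j => hdpos _
  refine ⟨c, ψ, hc, hψ, hψ0, hψ', ?_⟩
  filter_upwards [Metric.ball_mem_nhds x₀ (hdpos 0)] with x hx
  rw [mem_ball_iff_norm] at hx
  rcases eq_or_ne x x₀ with rfl | hne
  · simp [hψ0, hc]
  have hpos : 0 < ‖x - x₀‖ := norm_pos_iff.2 (sub_ne_zero.2 hne)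
  have hex : ∃ j, d j ≤ ‖x - x₀‖ := by
    obtain ⟨j, hj⟩ := exists_nat_one_div_lt hpos
    exact ⟨j, (min_le_right _ _).trans hj.le⟩
  classical
  obtain ⟨i, hi⟩ : ∃ i, Nat.find hex = i + 1 := by
    refine Nat.exists_eq_succ_of_ne_zero fun h0 => ?_
    have := Nat.find_spec hex
    rw [h0] at this
    exact absurd this (not_le.2 hx)
  have hlow : d (i + 1) ≤ ‖x - x₀‖ := hi ▸ Nat.find_spec hex
  have hup : ‖x - x₀‖ < d i := not_le.1 (Nat.find_min hex (by omega))
  refine le_trans ?_ (hrv i x (hup.trans_le (min_le_left _ _)))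
  rw [EReal.coe_le_coe_iff]
  linarith [hdom i _ hlow]

section Slices

variable {X Y Z : Type*} [NormedAddCommGroup X] [NormedSpace ℝ X] [NormedAddCommGroup Y]
  [NormedSpace ℝ Y] [NormedAddCommGroup Z] [NormedSpace ℝ Z] {F : X × Y × Z → ℝ} {x : X} {y : Y}
  {z : Z}

theorem fderiv_slice_fst (hF : DifferentiableAt ℝ F (x, y, z)) (h : X) :
    fderiv ℝ (fun x' => F (x', y, z)) x h = fderiv ℝ F (x, y, z) (h, 0, 0) := by
  have := hF.hasFDerivAt.comp (f := fun x' => (x', y, z)) x (hasFDerivAt_prodMk_left x (y, z))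
  rw [show (fun x' => F (x', y, z)) = F ∘ fun x' => (x', y, z) from rfl, this.fderiv]
  rfl

theorem fderiv_slice_snd (hF : DifferentiableAt ℝ F (x, y, z)) (h : Y) :
    fderiv ℝ (fun y' => F (x, y', z)) y h = fderiv ℝ F (x, y, z) (0, h, 0) := by
  have := hF.hasFDerivAt.comp (f := (fun p => (x, p)) ∘ fun y' => (y', z)) y
    ((hasFDerivAt_prodMk_right x (y, z)).comp (f := fun y' => (y', z)) y (hasFDerivAt_prodMk_left y z))
  rw [show (fun y' => F (x, y', z)) = F ∘ (fun p => (x, p)) ∘ fun y' => (y', z) from rfl,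
    this.fderiv]
  rfl

theorem fderiv_slice_trd (hF : DifferentiableAt ℝ F (x, y, z)) (h : Z) :
    fderiv ℝ (fun z' => F (x, y, z')) z h = fderiv ℝ F (x, y, z) (0, 0, h) := by
  have := hF.hasFDerivAt.comp z
    ((hasFDerivAt_prodMk_right x (y, z)).comp z (hasFDerivAt_prodMk_right y z))
  rw [show (fun z' => F (x, y, z')) = F ∘ (fun p => (x, p)) ∘ fun z' => (y, z') from rfl,
    this.fderiv]
  rfl

end Slices

/-- A critical point of a concave function is a global maximizer. -/
theorem ConcaveOn.le_of_fderiv_eq_zero {E : Type*} [NormedAddCommGroup E] [NormedSpace ℝ E]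
    {φ : E → ℝ} (hφ : ConcaveOn ℝ Set.univ φ) {y : E} (hd : DifferentiableAt ℝ φ y)
    (h0 : fderiv ℝ φ y = 0) (z : E) : φ z ≤ φ y := by
  have hline := hφ.comp_affineMap (AffineMap.lineMap y z : ℝ →ᵃ[ℝ] E)
  have hder : HasDerivAt (φ ∘ (AffineMap.lineMap y z : ℝ →ᵃ[ℝ] E)) 0 0 := by
    have h1 : HasFDerivAt φ (0 : E →L[ℝ] ℝ) (AffineMap.lineMap y z (0 : ℝ)) := by
      rw [AffineMap.lineMap_apply_zero, ← h0]
      exact hd.hasFDerivAt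
    simpa using h1.comp_hasDerivAt (0 : ℝ) AffineMap.hasDerivAt_lineMap
  have := ConcaveOn.slope_le_of_hasDerivAt hline (x := 0) (y := 1) (by simp) (by simp) one_pos hder
  simpa [slope_def_field] using this

section Lagrangian

variable {n m q : ℕ}
  {f : EuclideanSpace ℝ (Fin n) → EuclideanSpace ℝ (Fin m) → ℝ}
  {g : EuclideanSpace ℝ (Fin n) → EuclideanSpace ℝ (Fin m) → Fin q → ℝ}

/-- The Lagrangian as a function of the triple `(x, y, λ)`. -/
def lagJoint (f : EuclideanSpace ℝ (Fin n) → EuclideanSpace ℝ (Fin m) → ℝ)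
    (g : EuclideanSpace ℝ (Fin n) → EuclideanSpace ℝ (Fin m) → Fin q → ℝ)
    (w : EuclideanSpace ℝ (Fin n) × EuclideanSpace ℝ (Fin m) × (Fin q → ℝ)) : ℝ :=
  Lag f g w.1 w.2.1 w.2.2

theorem contDiff_lagJoint
    (hf : ContDiff ℝ 2 (fun p : EuclideanSpace ℝ (Fin n) × EuclideanSpace ℝ (Fin m) => f p.1 p.2))
    (hg : ∀ i, ContDiff ℝ 2
      (fun p : EuclideanSpace ℝ (Fin n) × EuclideanSpace ℝ (Fin m) => g p.1 p.2 i)) :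
    ContDiff ℝ 2 (lagJoint f g) := by
  have hp : ContDiff ℝ 2 fun w : EuclideanSpace ℝ (Fin n) × EuclideanSpace ℝ (Fin m) ×
      (Fin q → ℝ) => (w.1, w.2.1) := by fun_prop
  refine (hf.comp hp).sub (ContDiff.sum fun i _ => ContDiff.mul ?_ ((hg i).comp hp))
  fun_prop

variable (x : EuclideanSpace ℝ (Fin n)) (y : EuclideanSpace ℝ (Fin m)) (lam : Fin q → ℝ)

theorem inner_gradxL (hL : Differentiable ℝ (lagJoint f g)) (h : EuclideanSpace ℝ (Fin n)) :
    ⟪gradxL f g x y lam, h⟫ = fderiv ℝ (lagJoint f g) (x, y, lam) (h, 0, 0) := by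
  rw [← fderiv_slice_fst (hL _), gradxL, gradx, inner_gradient_left]
  rfl

theorem inner_gradyL (hL : Differentiable ℝ (lagJoint f g)) (h : EuclideanSpace ℝ (Fin m)) :
    ⟪gradyL f g x y lam, h⟫ = fderiv ℝ (lagJoint f g) (x, y, lam) (0, h, 0) := by
  rw [← fderiv_slice_snd (hL _), gradyL, grady, inner_gradient_left]
  rfl

theorem fderiv_lagJoint_trd (hL : Differentiable ℝ (lagJoint f g)) (κ : Fin q → ℝ) :
    fderiv ℝ (lagJoint f g) (x, y, lam) (0, 0, κ) = -∑ i, κ i * g x y i := by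
  rw [← fderiv_slice_trd (hL _)]
  have : HasFDerivAt (fun l : Fin q → ℝ => lagJoint f g (x, y, l))
      (-∑ i, g x y i • ContinuousLinearMap.proj (R := ℝ) (φ := fun _ : Fin q => ℝ) i) lam := by
    have hi : ∀ i, HasFDerivAt (fun l : Fin q → ℝ => l i * g x y i)
        (g x y i • ContinuousLinearMap.proj (R := ℝ) (φ := fun _ : Fin q => ℝ) i) lam :=
      fun i => (hasFDerivAt_apply i lam).mul_const _
    exact (HasFDerivAt.fun_sum fun i _ => hi i).const_sub (f x y)
  rw [this.fderiv]
  simp [mul_comm]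

theorem gradyL_eq
    (hf : ContDiff ℝ 2 (fun p : EuclideanSpace ℝ (Fin n) × EuclideanSpace ℝ (Fin m) => f p.1 p.2))
    (hg : ∀ i, ContDiff ℝ 2
      (fun p : EuclideanSpace ℝ (Fin n) × EuclideanSpace ℝ (Fin m) => g p.1 p.2 i)) :
    gradyL f g x y lam =
      grady f x y - ∑ i, lam i • grady (fun x y => g x y i) x y := by
  have hs : ContDiff ℝ 2 fun y' : EuclideanSpace ℝ (Fin m) => (x, y') := by fun_prop
  have hfd : DifferentiableAt ℝ (f x) y := ((hf.comp hs).differentiable two_ne_zero) y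
  have hgd : ∀ i, DifferentiableAt ℝ (fun y' => g x y' i) y := fun i =>
    (((hg i).comp hs).differentiable two_ne_zero) y
  have : HasFDerivAt (fun y' => Lag f g x y' lam)
      (fderiv ℝ (f x) y - ∑ i, lam i • fderiv ℝ (fun y' => g x y' i) y) y :=
    hfd.hasFDerivAt.sub (HasFDerivAt.fun_sum fun i _ => (hgd i).hasFDerivAt.const_mul _)
  simp only [gradyL, grady, gradient, this.fderiv, map_sub, map_sum, map_smulₛₗ]
  simp

theorem multSetP_grady_eq_sigmaSet
    (hf : ContDiff ℝ 2 (fun p : EuclideanSpace ℝ (Fin n) × EuclideanSpace ℝ (Fin m) => f p.1 p.2))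
    (hg : ∀ i, ContDiff ℝ 2
      (fun p : EuclideanSpace ℝ (Fin n) × EuclideanSpace ℝ (Fin m) => g p.1 p.2 i)) :
    MultSetP g (grady f x y) x y = SigmaSet f g x y := by
  ext lam
  simp only [MultSetP, SigmaSet, Set.mem_ofPred_eq, gradyL_eq x y lam hf hg]
  tauto

theorem continuous_grady
    (hf : ContDiff ℝ 2 (fun p : EuclideanSpace ℝ (Fin n) × EuclideanSpace ℝ (Fin m) => f p.1 p.2)) :
    Continuous fun p : EuclideanSpace ℝ (Fin n) × EuclideanSpace ℝ (Fin m) => grady f p.1 p.2 := by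
  refine (InnerProductSpace.toDual ℝ _).symm.continuous.comp ?_
  exact (ContDiff.fderiv (n := 0) (m := 2)
    (f := fun (p : EuclideanSpace ℝ (Fin n) × EuclideanSpace ℝ (Fin m)) y' => f p.1 y')
    (hf.comp (by fun_prop : ContDiff ℝ 2 fun z : (EuclideanSpace ℝ (Fin n) ×
      EuclideanSpace ℝ (Fin m)) × EuclideanSpace ℝ (Fin m) => (z.1.1, z.2)))
    contDiff_snd (by norm_num)).continuous

/-- Weak duality: a dual feasible Lagrangian value bounds the value function from above. -/
theorem vfun_le_lag (hL : Differentiable ℝ (lagJoint f g))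
    (hf : ConcaveOn ℝ Set.univ (f x)) (hg : ∀ i, ConvexOn ℝ Set.univ fun y => g x y i)
    (hlam : ∀ i, 0 ≤ lam i) (h0 : gradyL f g x y lam = 0) :
    Vfun f g x ≤ (Lag f g x y lam : EReal) := by
  have hconc : ConcaveOn ℝ Set.univ fun y' => Lag f g x y' lam := by
    refine hf.sub ?_
    have := Finset.sum_induction (s := Finset.univ) (fun i y' => lam i * g x y' i)
      (ConvexOn ℝ Set.univ) (fun _ _ => ConvexOn.add) (convexOn_const 0 convex_univ)
      fun i _ => (hg i).smul (hlam i)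
    rwa [Finset.sum_fn] at this
  have hd : DifferentiableAt ℝ (fun y' => Lag f g x y' lam) y :=
    (hL (x, y, lam)).comp (f := fun y' => (x, y', lam)) y (by fun_prop)
  have h0' : fderiv ℝ (fun y' => Lag f g x y' lam) y = 0 := by
    ext h
    rw [← inner_gradient_left]
    exact (congrArg (fun v => ⟪v, h⟫) h0).trans (inner_zero_left h)
  refine sSup_le ?_
  rintro _ ⟨z, hz, rfl⟩
  rw [EReal.coe_le_coe_iff]
  refine le_trans ?_ (hconc.le_of_fderiv_eq_zero hd h0' z)
  have : ∑ i, lam i * g x z i ≤ 0 :=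
    Finset.sum_nonpos fun i _ => mul_nonpos_of_nonneg_of_nonpos (hlam i) (hz i)
  simp only [Lag]
  linarith

theorem contDiff_inner_gradyL (hL : ContDiff ℝ 2 (lagJoint f g)) (u : EuclideanSpace ℝ (Fin m)) :
    ContDiff ℝ 1 fun w : EuclideanSpace ℝ (Fin n) × EuclideanSpace ℝ (Fin m) × (Fin q → ℝ) =>
      ⟪gradyL f g w.1 w.2.1 w.2.2, u⟫ := by
  have hd := hL.differentiable two_ne_zero
  simp only [inner_gradyL _ _ _ hd]
  exact (hL.fderiv_right (m := 1) (by norm_num)).clm_apply contDiff_const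

theorem inner_hessxyLu (hL : ContDiff ℝ 2 (lagJoint f g)) (u : EuclideanSpace ℝ (Fin m))
    (h : EuclideanSpace ℝ (Fin n)) :
    ⟪hessxyLu f g x y lam u, h⟫ =
      fderiv ℝ (fun w : EuclideanSpace ℝ (Fin n) × EuclideanSpace ℝ (Fin m) × (Fin q → ℝ) =>
        ⟪gradyL f g w.1 w.2.1 w.2.2, u⟫) (x, y, lam) (h, 0, 0) := by
  rw [← fderiv_slice_fst ((contDiff_inner_gradyL hL u).differentiable one_ne_zero _), hessxyLu,
    inner_gradient_left]

theorem inner_hessyyLu (hL : ContDiff ℝ 2 (lagJoint f g)) (u h : EuclideanSpace ℝ (Fin m)) :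
    ⟪hessyyLu f g x y lam u, h⟫ =
      fderiv ℝ (fun w : EuclideanSpace ℝ (Fin n) × EuclideanSpace ℝ (Fin m) × (Fin q → ℝ) =>
        ⟪gradyL f g w.1 w.2.1 w.2.2, u⟫) (x, y, lam) (0, h, 0) := by
  rw [← fderiv_slice_snd ((contDiff_inner_gradyL hL u).differentiable one_ne_zero _), hessyyLu,
    inner_gradient_left]

theorem fderiv_inner_gradyL_trd
    (hf : ContDiff ℝ 2 (fun p : EuclideanSpace ℝ (Fin n) × EuclideanSpace ℝ (Fin m) => f p.1 p.2))
    (hg : ∀ i, ContDiff ℝ 2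
      (fun p : EuclideanSpace ℝ (Fin n) × EuclideanSpace ℝ (Fin m) => g p.1 p.2 i))
    (u : EuclideanSpace ℝ (Fin m)) (κ : Fin q → ℝ) :
    fderiv ℝ (fun w : EuclideanSpace ℝ (Fin n) × EuclideanSpace ℝ (Fin m) × (Fin q → ℝ) =>
        ⟪gradyL f g w.1 w.2.1 w.2.2, u⟫) (x, y, lam) (0, 0, κ) =
      -∑ i, κ i * gyTu g x y u i := by
  have hK := (contDiff_inner_gradyL (contDiff_lagJoint hf hg) u).differentiable one_ne_zero
  rw [← fderiv_slice_trd (hK _)]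
  have hi : ∀ i, HasFDerivAt (fun l : Fin q → ℝ => l i * gyTu g x y u i)
      (gyTu g x y u i • ContinuousLinearMap.proj (R := ℝ) (φ := fun _ : Fin q => ℝ) i) lam :=
    fun i => (hasFDerivAt_apply i lam).mul_const _
  have hsum := (HasFDerivAt.fun_sum (u := Finset.univ) fun i _ => hi i).const_sub ⟪grady f x y, u⟫
  have heq : (fun l : Fin q → ℝ => ⟪gradyL f g x y l, u⟫) =
      fun l => ⟪grady f x y, u⟫ - ∑ i, l i * gyTu g x y u i := by
    ext l
    simp [gradyL_eq x y l hf hg, inner_sub_left, sum_inner, inner_smul_left, gyTu]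
  rw [heq, hsum.fderiv]
  simp [mul_comm]

theorem sum_smul_fderiv_wolfeH (hL : ContDiff ℝ 2 (lagJoint f g)) (u : EuclideanSpace ℝ (Fin m))
    (w : EuclideanSpace ℝ (Fin n) × EuclideanSpace ℝ (Fin m) × (Fin q → ℝ)) :
    ∑ j, u j • fderiv ℝ (fun w => WolfeH f g w j) w =
      fderiv ℝ (fun w : EuclideanSpace ℝ (Fin n) × EuclideanSpace ℝ (Fin m) × (Fin q → ℝ) =>
        ⟪gradyL f g w.1 w.2.1 w.2.2, u⟫) w := by
  have hH : ∀ j, DifferentiableAt ℝ (fun w => WolfeH f g w j) w := by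
    intro j
    have := (contDiff_inner_gradyL hL (EuclideanSpace.single j 1)).differentiable one_ne_zero w
    simpa [WolfeH, EuclideanSpace.inner_single_right] using this
  have hsum := HasFDerivAt.fun_sum (u := Finset.univ) fun j _ =>
    (hH j).hasFDerivAt.const_mul (u j)
  rw [← hsum.fderiv]
  congr 1

theorem sum_smul_fderiv_wolfeG_apply (α : Fin q → ℝ)
    (w h : EuclideanSpace ℝ (Fin n) × EuclideanSpace ℝ (Fin m) × (Fin q → ℝ)) :
    (∑ i, α i • fderiv ℝ (fun w => WolfeG n m q w i) w) h = -∑ i, α i * h.2.2 i := by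
  have hG : ∀ i, HasFDerivAt (fun w => WolfeG n m q w i)
      (-(ContinuousLinearMap.proj (R := ℝ) (φ := fun _ : Fin q => ℝ) i ∘L
        ContinuousLinearMap.snd ℝ (EuclideanSpace ℝ (Fin m)) (Fin q → ℝ) ∘L
        ContinuousLinearMap.snd ℝ (EuclideanSpace ℝ (Fin n)) _)) w := fun i =>
    (-(ContinuousLinearMap.proj (R := ℝ) (φ := fun _ : Fin q => ℝ) i ∘L
        ContinuousLinearMap.snd ℝ (EuclideanSpace ℝ (Fin m)) (Fin q → ℝ) ∘L
        ContinuousLinearMap.snd ℝ (EuclideanSpace ℝ (Fin n)) _)).hasFDerivAt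
  simp [fun i => (hG i).fderiv]

/-- The linear functional `(⟨v, ·⟩, 0, 0) - r DL(x, y, λ)`. -/
noncomputable def dualFunctional (f : EuclideanSpace ℝ (Fin n) → EuclideanSpace ℝ (Fin m) → ℝ)
    (g : EuclideanSpace ℝ (Fin n) → EuclideanSpace ℝ (Fin m) → Fin q → ℝ) (r : ℝ)
    (v : EuclideanSpace ℝ (Fin n))
    (w : EuclideanSpace ℝ (Fin n) × EuclideanSpace ℝ (Fin m) × (Fin q → ℝ)) :
    (EuclideanSpace ℝ (Fin n) × EuclideanSpace ℝ (Fin m) × (Fin q → ℝ)) →L[ℝ] ℝ :=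
  innerSL ℝ v ∘L ContinuousLinearMap.fst ℝ _ _ - r • fderiv ℝ (lagJoint f g) w

theorem dualFunctional_mul (s r : ℝ) (v : EuclideanSpace ℝ (Fin n))
    (w : EuclideanSpace ℝ (Fin n) × EuclideanSpace ℝ (Fin m) × (Fin q → ℝ)) :
    dualFunctional f g (s * r) (s • v) w = s • dualFunctional f g r v w := by
  simp [dualFunctional, smul_sub, mul_smul, ContinuousLinearMap.smul_comp]

theorem continuous_dualFunctional (hL : ContDiff ℝ 2 (lagJoint f g)) :
    Continuous fun p : ℝ × EuclideanSpace ℝ (Fin n) ×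
      (EuclideanSpace ℝ (Fin n) × EuclideanSpace ℝ (Fin m) × (Fin q → ℝ)) =>
        dualFunctional f g p.1 p.2.1 p.2.2 := by
  have h := hL.continuous_fderiv two_ne_zero
  have h1 : Continuous fun v : EuclideanSpace ℝ (Fin n) => innerSL ℝ v ∘L
      ContinuousLinearMap.fst ℝ (EuclideanSpace ℝ (Fin n))
        (EuclideanSpace ℝ (Fin m) × (Fin q → ℝ)) :=
    (innerSL ℝ (E := EuclideanSpace ℝ (Fin n))).continuous.clm_comp continuous_const
  exact (h1.comp continuous_snd.fst).sub (continuous_fst.smul (h.comp continuous_snd.snd))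

theorem MultSetW.nonempty_smul {W : Type} [NormedAddCommGroup W] [NormedSpace ℝ W] {p p' : ℕ}
    {G : W → Fin p → ℝ} {H : W → Fin p' → ℝ} {β : W →L[ℝ] ℝ} {w : W} {s : ℝ} (hs : 0 ≤ s)
    (h : (MultSetW G H β w).Nonempty) : (MultSetW G H (s • β) w).Nonempty := by
  obtain ⟨⟨a, b⟩, ha, hab, hc⟩ := h
  refine ⟨(s • a, s • b), fun i => mul_nonneg hs (ha i), ?_, ?_⟩
  · have := congrArg (s • ·) hab
    simpa [smul_sub, Finset.smul_sum, smul_smul] using this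
  · have := congrArg (s * ·) hc
    simpa [Finset.mul_sum, mul_assoc] using this

/-- Multipliers of the Wolfe dual system at a primal-dual optimal triple describe
the (horizon) subgradient. -/
theorem exists_mem_xiSet_of_multSetW
    (hf : ContDiff ℝ 2 (fun p : EuclideanSpace ℝ (Fin n) × EuclideanSpace ℝ (Fin m) => f p.1 p.2))
    (hg : ∀ i, ContDiff ℝ 2
      (fun p : EuclideanSpace ℝ (Fin n) × EuclideanSpace ℝ (Fin m) => g p.1 p.2 i))
    (hlam : lam ∈ SigmaSet f g x y) {r : ℝ} {v : EuclideanSpace ℝ (Fin n)}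
    (hne : (MultSetW (WolfeG n m q) (WolfeH f g) (dualFunctional f g r v (x, y, lam))
      (x, y, lam)).Nonempty) :
    ∃ u ∈ XiSet r f g x y lam, v = r • gradxL f g x y lam + hessxyLu f g x y lam u := by
  obtain ⟨⟨α, μ⟩, hα, hαμ, hc⟩ := hne
  have hL := contDiff_lagJoint hf hg
  have hd := hL.differentiable two_ne_zero
  set u : EuclideanSpace ℝ (Fin m) := WithLp.toLp 2 μ with hu
  have hsum := sum_smul_fderiv_wolfeH hL u (x, y, lam)
  simp only at hα hαμ hc
  rw [show (∑ j, μ j • fderiv ℝ (fun w => WolfeH f g w j) (x, y, lam)) = _ from hsum] at hαμ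
  have key : ∀ h : EuclideanSpace ℝ (Fin n) × EuclideanSpace ℝ (Fin m) × (Fin q → ℝ),
      ⟪v, h.1⟫ - r * fderiv ℝ (lagJoint f g) (x, y, lam) h + ∑ i, α i * h.2.2 i -
        fderiv ℝ (fun w : EuclideanSpace ℝ (Fin n) × EuclideanSpace ℝ (Fin m) × (Fin q → ℝ) =>
          ⟪gradyL f g w.1 w.2.1 w.2.2, u⟫) (x, y, lam) h = 0 := by
    intro h
    have := DFunLike.congr_fun hαμ h
    rw [sub_apply, sub_apply, sum_smul_fderiv_wolfeG_apply] at this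
    simpa [dualFunctional] using this
  have hαi : ∀ i, α i = -gyTu g x y u i - r * g x y i := by
    intro i
    have := key (0, 0, Pi.single i 1)
    rw [fderiv_lagJoint_trd x y lam hd, fderiv_inner_gradyL_trd x y lam hf hg] at this
    simp [Pi.single_apply] at this
    linarith
  refine ⟨u, ⟨?_, fun i => hαi i ▸ hα i, hlam.2.1, ?_⟩, ?_⟩
  · refine ext_inner_right ℝ fun h => ?_
    have := key (0, h, 0)
    rw [← inner_gradyL x y lam hd, ← inner_hessyyLu x y lam hL, hlam.1] at this
    simpa using this
  · simp only [← hαi]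
    have : -∑ i, α i * lam i = 0 := by simpa [WolfeG] using hc
    simpa [mul_comm] using this
  · refine ext_inner_right ℝ fun h => ?_
    have := key (h, 0, 0)
    rw [← inner_gradxL x y lam hd, ← inner_hessxyLu x y lam hL] at this
    rw [inner_add_left, real_inner_smul_left]
    simp at this
    linarith

/-- At a primal-dual optimal triple, a Fréchet subgradient of the value function produces
multipliers for the Wolfe dual system. -/
theorem multSetW_nonempty_of_mem_FSub (hL : ContDiff ℝ 2 (lagJoint f g))
    (hconv : ∀ᶠ x' in 𝓝 x,
      ConcaveOn ℝ Set.univ (f x') ∧ ∀ i, ConvexOn ℝ Set.univ fun y => g x' y i)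
    (hy : y ∈ Sol f g x) (hlam : lam ∈ SigmaSet f g x y)
    (hcq : CQAt (WolfeG n m q) (WolfeH f g) (x, y, lam)) {v : EuclideanSpace ℝ (Fin n)}
    (hv : v ∈ FSub (Vfun f g) x) :
    (MultSetW (WolfeG n m q) (WolfeH f g) (dualFunctional f g 1 v (x, y, lam))
      (x, y, lam)).Nonempty := by
  obtain ⟨c, ψ, hc, hψ, hψ0, hψ', hmin⟩ := exists_contDiff_one_minorant_of_mem_FSub hv
  set θ : EuclideanSpace ℝ (Fin n) × EuclideanSpace ℝ (Fin m) × (Fin q → ℝ) → ℝ := fun w =>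
    lagJoint f g w - ⟪v, w.1 - x⟫ + ψ (w.1 - x) with hθ
  have hfc : f x y = c := by
    have := hy.2.trans hc
    exact_mod_cast this
  have hθC : ContDiff ℝ 1 θ := by
    have h1 : ContDiff ℝ 1 (lagJoint f g) := hL.of_le (by norm_num)
    have h2 : ContDiff ℝ 1 fun w : EuclideanSpace ℝ (Fin n) × EuclideanSpace ℝ (Fin m) ×
        (Fin q → ℝ) => w.1 - x := by fun_prop
    exact (h1.sub (contDiff_const.inner ℝ h2)).add (hψ.comp h2)
  have hθ' : fderiv ℝ θ (x, y, lam) = -dualFunctional f g 1 v (x, y, lam) := by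
    have h1 := (hL.differentiable two_ne_zero (x, y, lam)).hasFDerivAt
    have h2 : HasFDerivAt (fun w : EuclideanSpace ℝ (Fin n) × EuclideanSpace ℝ (Fin m) ×
        (Fin q → ℝ) => w.1 - x) (ContinuousLinearMap.fst ℝ _ _) (x, y, lam) :=
      hasFDerivAt_fst.sub_const x
    have h3 : HasFDerivAt (fun w : EuclideanSpace ℝ (Fin n) × EuclideanSpace ℝ (Fin m) ×
        (Fin q → ℝ) => ⟪v, w.1 - x⟫) (innerSL ℝ v ∘L ContinuousLinearMap.fst ℝ _ _)
        (x, y, lam) :=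
      (innerSL ℝ v).hasFDerivAt.comp (x, y, lam) h2
    have h4 : HasFDerivAt ψ (0 : EuclideanSpace ℝ (Fin n) →L[ℝ] ℝ) (x - x) := by
      rw [sub_self, ← hψ']
      exact (hψ.differentiable one_ne_zero 0).hasFDerivAt
    have h5 := (h1.sub h3).add (h4.comp (x, y, lam) h2)
    rw [show θ = (lagJoint f g - fun w => ⟪v, w.1 - x⟫) + ψ ∘ fun w => w.1 - x from rfl,
      h5.fderiv]
    simp [dualFunctional]
  have hlag : Lag f g x y lam = c := by
    rw [Lag, hlam.2.2.2, hfc, sub_zero]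
  have hloc : IsLocalMinOn θ {w | (∀ i, WolfeG n m q w i ≤ 0) ∧ ∀ j, WolfeH f g w j = 0}
      (x, y, lam) := by
    have hev : ∀ᶠ w : EuclideanSpace ℝ (Fin n) × EuclideanSpace ℝ (Fin m) × (Fin q → ℝ) in
        𝓝 (x, y, lam), (ConcaveOn ℝ Set.univ (f w.1) ∧
          ∀ i, ConvexOn ℝ Set.univ fun y => g w.1 y i) ∧
          ((c + ⟪v, w.1 - x⟫ - ψ (w.1 - x) : ℝ) : EReal) ≤ Vfun f g w.1 :=
      (continuous_fst.tendsto (x, y, lam)).eventually (hconv.and hmin)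
    filter_upwards [mem_nhdsWithin_of_mem_nhds hev, self_mem_nhdsWithin] with w hw hwF
    have hdual := vfun_le_lag w.1 w.2.1 w.2.2 (hL.differentiable two_ne_zero) hw.1.1 hw.1.2
      (fun i => by simpa [WolfeG] using hwF.1 i) (by ext j; exact hwF.2 j)
    have := EReal.coe_le_coe_iff.1 (hw.2.trans hdual)
    simp only [hθ, lagJoint, hlag, sub_self, inner_zero_right, hψ0]
    linarith
  obtain ⟨α, μ, hα, heq, hcomp⟩ := hcq θ hθC hloc
  refine ⟨(α, μ), hα, ?_, hcomp⟩
  rw [hθ'] at heq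
  rw [sub_sub, sub_eq_zero]
  rw [add_assoc, neg_add_eq_zero] at heq
  exact heq

/-- Optimal solutions and multipliers along a sequence of parameters have cluster points among
those of the limiting problem. -/
theorem exists_subseq_sol_sigmaSet
    (hf : ContDiff ℝ 2 (fun p : EuclideanSpace ℝ (Fin n) × EuclideanSpace ℝ (Fin m) => f p.1 p.2))
    (hg : ∀ i, ContDiff ℝ 2
      (fun p : EuclideanSpace ℝ (Fin n) × EuclideanSpace ℝ (Fin m) => g p.1 p.2 i))
    {xb : EuclideanSpace ℝ (Fin n)} (hrsc : RestrictedSupCompact f g xb)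
    (hpcq : ∀ y ∈ Sol f g xb, StableParamCQ f g xb y) {xk : ℕ → EuclideanSpace ℝ (Fin n)}
    (hxk : Tendsto xk atTop (𝓝 xb))
    (hVk : Tendsto (fun k => Vfun f g (xk k)) atTop (𝓝 (Vfun f g xb))) :
    ∃ φ : ℕ → ℕ, StrictMono φ ∧ ∃ (yk : ℕ → EuclideanSpace ℝ (Fin m)) (lamk : ℕ → Fin q → ℝ),
      (∀ k, yk k ∈ Sol f g (xk (φ k))) ∧ (∀ k, lamk k ∈ SigmaSet f g (xk (φ k)) (yk k)) ∧
      ∃ yb ∈ Sol f g xb, ∃ lamb ∈ SigmaSet f g xb yb,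
        Tendsto yk atTop (𝓝 yb) ∧ Tendsto lamk atTop (𝓝 lamb) := by
  obtain ⟨⟨c, hc⟩, ε, δ, hε, hδ, Ω, hΩ, hsol⟩ := hrsc
  have hlt : Vfun f g xb - (ε : EReal) < Vfun f g xb := by
    rw [hc, ← EReal.coe_sub, EReal.coe_lt_coe_iff]
    linarith
  have hev : ∀ᶠ k in atTop, (Sol f g (xk k) ∩ Ω).Nonempty := by
    filter_upwards [hxk.eventually (Metric.ball_mem_nhds xb hδ),
      hVk.eventually (lt_mem_nhds hlt)] with k hk1 hk2
    exact hsol _ (mem_ball_iff_norm.1 hk1) hk2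
  obtain ⟨φ₁, hφ₁, hne⟩ := extraction_of_eventually_atTop hev
  choose yk hyk using hne
  obtain ⟨yb, -, φ₂, hφ₂, hyb⟩ := hΩ.tendsto_subseq fun k => (hyk k).2
  set x₂ : ℕ → EuclideanSpace ℝ (Fin n) := fun k => xk (φ₁ (φ₂ k)) with hx₂
  set y₂ : ℕ → EuclideanSpace ℝ (Fin m) := fun k => yk (φ₂ k) with hy₂
  have hx₂t : Tendsto x₂ atTop (𝓝 xb) :=
    hxk.comp (hφ₁.tendsto_atTop.comp hφ₂.tendsto_atTop)
  have hy₂t : Tendsto y₂ atTop (𝓝 yb) := hyb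
  have hxy : Tendsto (fun k => (x₂ k, y₂ k)) atTop (𝓝 (xb, yb)) := hx₂t.prodMk_nhds hy₂t
  have hS₂ : ∀ k, y₂ k ∈ Sol f g (x₂ k) := fun k => (hyk (φ₂ k)).1
  have hybS : yb ∈ Sol f g xb := by
    refine ⟨fun i => ?_, ?_⟩
    · exact le_of_tendsto' (((hg i).continuous.tendsto (xb, yb)).comp hxy) fun k => (hS₂ k).1 i
    · have h1 : Tendsto (fun k => (f (x₂ k) (y₂ k) : EReal)) atTop (𝓝 (f xb yb : EReal)) :=
        (continuous_coe_real_ereal.tendsto _).comp ((hf.continuous.tendsto (xb, yb)).comp hxy)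
      have h2 : Tendsto (fun k => Vfun f g (x₂ k)) atTop (𝓝 (Vfun f g xb)) :=
        hVk.comp (hφ₁.tendsto_atTop.comp hφ₂.tendsto_atTop)
      simp only [fun k => (hS₂ k).2] at h1
      exact tendsto_nhds_unique h1 h2
  obtain ⟨P, ⟨η, hη, hP⟩, hPmax, hPseq⟩ := hpcq yb hybS
  have hevP : ∀ᶠ k in atTop, (MultSetP g (grady f (x₂ k) (y₂ k)) (x₂ k) (y₂ k)).Nonempty := by
    filter_upwards [hx₂t.eventually (Metric.ball_mem_nhds xb hη),
      hy₂t.eventually (Metric.ball_mem_nhds yb hη)] with k hk1 hk2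
    refine hPmax _ _ (hP _ _ (hS₂ k).1 (mem_ball_iff_norm.1 hk1) (mem_ball_iff_norm.1 hk2))
      (hS₂ k).1 (IsMaxOn.localize fun z hz => ?_)
    have : (f (x₂ k) z : EReal) ≤ f (x₂ k) (y₂ k) := by
      rw [(hS₂ k).2]
      exact le_sSup ⟨z, hz, rfl⟩
    exact EReal.coe_le_coe_iff.1 this
  obtain ⟨φ₃, hφ₃, hne₃⟩ := extraction_of_eventually_atTop hevP
  obtain ⟨lamk, φ₄, lamb, hφ₄, hlamk, hlamt, hlamb⟩ :=
    hPseq (fun k => grady f (x₂ (φ₃ k)) (y₂ (φ₃ k))) (x₂ ∘ φ₃) (y₂ ∘ φ₃) (grady f xb yb)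
      (((continuous_grady hf).tendsto (xb, yb)).comp (hxy.comp hφ₃.tendsto_atTop))
      (hx₂t.comp hφ₃.tendsto_atTop) (hy₂t.comp hφ₃.tendsto_atTop) hne₃
  refine ⟨fun k => φ₁ (φ₂ (φ₃ (φ₄ k))), hφ₁.comp (hφ₂.comp (hφ₃.comp hφ₄)),
    fun k => y₂ (φ₃ (φ₄ k)), lamk ∘ φ₄, fun k => hS₂ _, fun k => ?_, yb, hybS, lamb, ?_,
    hy₂t.comp (hφ₃.tendsto_atTop.comp hφ₄.tendsto_atTop), hlamt⟩
  · rw [← multSetP_grady_eq_sigmaSet _ _ hf hg]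
    exact hlamk (φ₄ k)
  · rwa [← multSetP_grady_eq_sigmaSet _ _ hf hg]

/-- Common estimate for the limiting (`r = 1`) and horizon (`r = 0`) subdifferentials. -/
theorem exists_xiSet_of_tendsto_smul
    (hf : ContDiff ℝ 2 (fun p : EuclideanSpace ℝ (Fin n) × EuclideanSpace ℝ (Fin m) => f p.1 p.2))
    (hg : ∀ i, ContDiff ℝ 2
      (fun p : EuclideanSpace ℝ (Fin n) × EuclideanSpace ℝ (Fin m) => g p.1 p.2 i))
    {xb : EuclideanSpace ℝ (Fin n)}
    (hconv : ∃ δ : ℝ, 0 < δ ∧ ∀ x ∈ Metric.ball xb δ,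
      ConcaveOn ℝ Set.univ (f x) ∧ ∀ i, ConvexOn ℝ Set.univ (fun y => g x y i))
    (hrsc : RestrictedSupCompact f g xb)
    (hpcq : ∀ y ∈ Sol f g xb, StableParamCQ f g xb y)
    (hscq : ∀ y ∈ Sol f g xb, ∀ lam ∈ SigmaSet f g xb y,
      StableCQ (WolfeG n m q) (WolfeH f g) (xb, y, lam))
    {xk vk : ℕ → EuclideanSpace ℝ (Fin n)} {sk : ℕ → ℝ} {r : ℝ} {v : EuclideanSpace ℝ (Fin n)}
    (hv : ∀ k, vk k ∈ FSub (Vfun f g) (xk k)) (hxk : Tendsto xk atTop (𝓝 xb))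
    (hVk : Tendsto (fun k => Vfun f g (xk k)) atTop (𝓝 (Vfun f g xb)))
    (hsk : ∀ k, 0 ≤ sk k) (hskr : Tendsto sk atTop (𝓝 r))
    (hskv : Tendsto (fun k => sk k • vk k) atTop (𝓝 v)) :
    ∃ y ∈ Sol f g xb, ∃ lam ∈ SigmaSet f g xb y, ∃ u ∈ XiSet r f g xb y lam,
      v = r • gradxL f g xb y lam + hessxyLu f g xb y lam u := by
  have hL := contDiff_lagJoint hf hg
  obtain ⟨φ, hφ, yk, lamk, hyk, hlamk, yb, hyb, lamb, hlamb, hyt, hlamt⟩ :=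
    exists_subseq_sol_sigmaSet hf hg hrsc hpcq hxk hVk
  have hxt := hxk.comp hφ.tendsto_atTop
  have hwt : Tendsto (fun k => (xk (φ k), yk k, lamk k)) atTop (𝓝 (xb, yb, lamb)) :=
    hxt.prodMk_nhds (hyt.prodMk_nhds hlamt)
  obtain ⟨δ, hδ, hball⟩ := hconv
  obtain ⟨P, ⟨-, η, hη, hP⟩, hPmin, hPseq⟩ := hscq yb hyb lamb hlamb
  have hfeas : ∀ k, (∀ i, WolfeG n m q (xk (φ k), yk k, lamk k) i ≤ 0) ∧
      ∀ j, WolfeH f g (xk (φ k), yk k, lamk k) j = 0 := fun k =>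
    ⟨fun i => neg_nonpos.2 ((hlamk k).2.1 i), fun j => by simp [WolfeH, (hlamk k).1]⟩
  have hev : ∀ᶠ k in atTop, (MultSetW (WolfeG n m q) (WolfeH f g)
      (dualFunctional f g (sk (φ k)) (sk (φ k) • vk (φ k)) (xk (φ k), yk k, lamk k))
      (xk (φ k), yk k, lamk k)).Nonempty := by
    filter_upwards [hwt.eventually (Metric.ball_mem_nhds _ hη),
      hxt.eventually (Metric.ball_mem_nhds _ hδ)] with k hk1 hk2
    have hPk := hP _ (hfeas k).1 (hfeas k).2 (mem_ball_iff_norm.1 hk1)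
    have h1 := multSetW_nonempty_of_mem_FSub _ _ _ hL
      (Filter.mem_of_superset (Metric.isOpen_ball.mem_nhds hk2) hball) (hyk k) (hlamk k)
      (hPmin _ hPk (hfeas k).1 (hfeas k).2) (hv (φ k))
    have h2 := MultSetW.nonempty_smul (hsk (φ k)) h1
    rwa [← dualFunctional_mul, mul_one] at h2
  obtain ⟨φ', hφ', hne⟩ := extraction_of_eventually_atTop hev
  have hcont := (((continuous_dualFunctional hL).tendsto (r, v, (xb, yb, lamb))).comp
    ((hskr.comp hφ.tendsto_atTop).prodMk_nhds
      ((hskv.comp hφ.tendsto_atTop).prodMk_nhds hwt))).comp hφ'.tendsto_atTop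
  obtain ⟨-, -, lmb, -, -, -, hlmb⟩ :=
    hPseq _ _ _ hcont (hwt.comp hφ'.tendsto_atTop) (fun k => hfeas (φ' k)) hne
  obtain ⟨u, hu, hvu⟩ := exists_mem_xiSet_of_multSetW xb yb lamb hf hg hlamb ⟨lmb, hlmb⟩
  exact ⟨yb, hyb, lamb, hlamb, u, hu, hvu⟩

end Lagrangian

/-- Theorem 3.4, limiting and horizon subdifferential estimates. -/
theorem stmt6 {n m q : ℕ}
    (f : EuclideanSpace ℝ (Fin n) → EuclideanSpace ℝ (Fin m) → ℝ)
    (g : EuclideanSpace ℝ (Fin n) → EuclideanSpace ℝ (Fin m) → Fin q → ℝ)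
    (hf : ContDiff ℝ 2 (fun p : EuclideanSpace ℝ (Fin n) × EuclideanSpace ℝ (Fin m) => f p.1 p.2))
    (hg : ∀ i, ContDiff ℝ 2
      (fun p : EuclideanSpace ℝ (Fin n) × EuclideanSpace ℝ (Fin m) => g p.1 p.2 i))
    (xb : EuclideanSpace ℝ (Fin n))
    (hconv : ∃ δ : ℝ, 0 < δ ∧ ∀ x ∈ Metric.ball xb δ,
      ConcaveOn ℝ Set.univ (f x) ∧ ∀ i, ConvexOn ℝ Set.univ (fun y => g x y i))
    (hrsc : RestrictedSupCompact f g xb)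
    (hpcq : ∀ y ∈ Sol f g xb, StableParamCQ f g xb y)
    (hscq : ∀ y ∈ Sol f g xb, ∀ lam ∈ SigmaSet f g xb y,
      StableCQ (WolfeG n m q) (WolfeH f g) (xb, y, lam)) :
    LSub (Vfun f g) xb ⊆
      {v | ∃ y ∈ Sol f g xb, ∃ lam ∈ SigmaSet f g xb y, ∃ u ∈ XiSet 1 f g xb y lam,
        v = gradxL f g xb y lam + hessxyLu f g xb y lam u} ∧
    HorSub (Vfun f g) xb ⊆
      {v | ∃ y ∈ Sol f g xb, ∃ lam ∈ SigmaSet f g xb y, ∃ u ∈ XiSet 0 f g xb y lam,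
        v = hessxyLu f g xb y lam u} := by
  constructor
  · rintro v ⟨xk, vk, hv, hxk, hVk, hvk⟩
    obtain ⟨y, hy, lam, hlam, u, hu, h⟩ := exists_xiSet_of_tendsto_smul (sk := fun _ => 1) (r := 1)
      hf hg hconv hrsc hpcq hscq hv hxk hVk (fun _ => zero_le_one) tendsto_const_nhds
      (by simpa using hvk)
    exact ⟨y, hy, lam, hlam, u, hu, by simpa using h⟩
  · rintro v ⟨xk, vk, tk, hv, htk, ht0, hxk, hVk, hvk⟩
    obtain ⟨y, hy, lam, hlam, u, hu, h⟩ := exists_xiSet_of_tendsto_smul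
      hf hg hconv hrsc hpcq hscq hv hxk hVk (fun k => (htk k).le) ht0 hvk
    exact ⟨y, hy, lam, hlam, u, hu, by simpa using h⟩
end

section
/- Assume f, g are twice continuously differentiable. Let y ∈ S(x̄) and λ ∈ Σ(x̄,y). If the second order sufficient condition (SOSC) holds at (y,λ) for problem (P_x̄), then Ξ⁰(x̄,y,λ) = Ξ¹(x̄,y,λ) = {0}. -/
open Filter Topology Metric RealInnerProductSpace

theorem XiSet_subset_CritCone {n m q : ℕ} {r : ℝ}
    {f : EuclideanSpace ℝ (Fin n) → EuclideanSpace ℝ (Fin m) → ℝ}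
    {g : EuclideanSpace ℝ (Fin n) → EuclideanSpace ℝ (Fin m) → Fin q → ℝ}
    {x : EuclideanSpace ℝ (Fin n)} {y : EuclideanSpace ℝ (Fin m)} {lam : Fin q → ℝ} :
    XiSet r f g x y lam ⊆ CritCone g x y lam := by
  rintro u ⟨-, hu, hl, hsum⟩ i hi
  have hterm := (Finset.sum_eq_zero_iff_of_nonneg
    (fun j _ => mul_nonneg (hl j) (hu j))).1 hsum i (Finset.mem_univ i)
  have hui := hu i
  rw [hi, mul_zero, sub_zero] at hterm hui
  refine ⟨fun hpos => ?_, fun _ => neg_nonneg.1 hui⟩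
  exact neg_eq_zero.1 ((mul_eq_zero.1 hterm).resolve_left hpos.ne')

theorem hessyyLu_zero {n m q : ℕ}
    (f : EuclideanSpace ℝ (Fin n) → EuclideanSpace ℝ (Fin m) → ℝ)
    (g : EuclideanSpace ℝ (Fin n) → EuclideanSpace ℝ (Fin m) → Fin q → ℝ)
    (x : EuclideanSpace ℝ (Fin n)) (y : EuclideanSpace ℝ (Fin m)) (lam : Fin q → ℝ) :
    hessyyLu f g x y lam 0 = 0 := by
  simp [hessyyLu, gradient]

theorem zero_mem_XiSet {n m q : ℕ} {r : ℝ} (hr : 0 ≤ r)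
    {f : EuclideanSpace ℝ (Fin n) → EuclideanSpace ℝ (Fin m) → ℝ}
    {g : EuclideanSpace ℝ (Fin n) → EuclideanSpace ℝ (Fin m) → Fin q → ℝ}
    {x : EuclideanSpace ℝ (Fin n)} {y : EuclideanSpace ℝ (Fin m)} {lam : Fin q → ℝ}
    (hlam : lam ∈ SigmaSet f g x y) : 0 ∈ XiSet r f g x y lam := by
  obtain ⟨-, hl, hg, hcomp⟩ := hlam
  refine ⟨hessyyLu_zero f g x y lam, fun i => ?_, hl, ?_⟩
  · simpa [gyTu] using mul_nonpos_of_nonneg_of_nonpos hr (hg i)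
  · simp only [gyTu, inner_zero_right, neg_zero, zero_sub, mul_neg, Finset.sum_neg_distrib,
      mul_left_comm _ r, ← Finset.mul_sum, hcomp, mul_zero]

theorem SOSC.XiSet_eq {n m q : ℕ} {r : ℝ} (hr : 0 ≤ r)
    {f : EuclideanSpace ℝ (Fin n) → EuclideanSpace ℝ (Fin m) → ℝ}
    {g : EuclideanSpace ℝ (Fin n) → EuclideanSpace ℝ (Fin m) → Fin q → ℝ}
    {x : EuclideanSpace ℝ (Fin n)} {y : EuclideanSpace ℝ (Fin m)} {lam : Fin q → ℝ}
    (hsosc : SOSC f g x y lam) (hlam : lam ∈ SigmaSet f g x y) :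
    XiSet r f g x y lam = {0} := by
  refine Set.eq_singleton_iff_unique_mem.2 ⟨zero_mem_XiSet hr hlam, fun u hu => ?_⟩
  by_contra hne
  have hneg := hsosc u (XiSet_subset_CritCone hu) hne
  rw [hu.1, inner_zero_right] at hneg
  exact hneg.false

/-- Proposition 3.3 — SOSC implies `Ξ⁰ = Ξ¹ = {0}`. -/
theorem stmt9 {n m q : ℕ}
    (f : EuclideanSpace ℝ (Fin n) → EuclideanSpace ℝ (Fin m) → ℝ)
    (g : EuclideanSpace ℝ (Fin n) → EuclideanSpace ℝ (Fin m) → Fin q → ℝ)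
    (hf : ContDiff ℝ 2 (fun p : EuclideanSpace ℝ (Fin n) × EuclideanSpace ℝ (Fin m) => f p.1 p.2))
    (hg : ∀ i, ContDiff ℝ 2
      (fun p : EuclideanSpace ℝ (Fin n) × EuclideanSpace ℝ (Fin m) => g p.1 p.2 i))
    (xb : EuclideanSpace ℝ (Fin n)) (y : EuclideanSpace ℝ (Fin m)) (lam : Fin q → ℝ)
    (hy : y ∈ Sol f g xb) (hlam : lam ∈ SigmaSet f g xb y)
    (hsosc : SOSC f g xb y lam) :
    XiSet 0 f g xb y lam = {0} ∧ XiSet 1 f g xb y lam = {0} := by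
  exact ⟨hsosc.XiSet_eq le_rfl hlam, hsosc.XiSet_eq zero_le_one hlam⟩
end
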